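/- Let p be an odd prime, let G be a non-Abelian finite p-group, and let m be the largest non-negative integer such that some non-linear irreducible complex character of G has kernel of order p^m. Then either G' is the unique normal subgroup of G of order p^{m+1}, or |G'| ≤ p^m. -/

import Mathlib

open CategoryTheory

/-- The kernel of the character of a complex representation `V` of `G`:
`ker χ = {g ∈ G : χ(g) = χ(1)}`. -/
noncomputable def charKer {G : Type} [Group G] (V : FDRep ℂ G) : Set G :=
  {g | V.character g = V.character 1}

/-- The center of the character of a complex representation `V` of `G`:
`Z(χ) = {g ∈ G : |χ(g)| = χ(1)}`. -/
noncomputable def charCenter {G : Type} [Group G] (V : FDRep ℂ G) : Set G :=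
  {g | (‖V.character g‖ : ℂ) = V.character 1}

/-- A complex endomorphism of finite order whose trace is the dimension is the identity. -/
theorem Module.End.eq_one_of_pow_eq_one_of_trace_eq_finrank {W : Type*} [AddCommGroup W]
    [Module ℂ W] [FiniteDimensional ℂ W] {f : Module.End ℂ W} {n : ℕ} (hn : n ≠ 0)
    (hf : f ^ n = 1) (htr : LinearMap.trace ℂ W f = Module.finrank ℂ W) : f = 1 := by
  have hsplits : f.charpoly.Splits := IsAlgClosed.splits _
  have hcard : f.charpoly.roots.card = Module.finrank ℂ W := by
    rw [← LinearMap.charpoly_natDegree f]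
    exact hsplits.natDegree_eq_card_roots.symm
  have hnorm : ∀ μ ∈ f.charpoly.roots, ‖μ‖ = 1 := by
    intro μ hμ
    have hev := (f.hasEigenvalue_iff_isRoot_charpoly μ).2 (Polynomial.isRoot_of_mem_roots hμ)
    obtain ⟨v, hv⟩ := hev.exists_hasEigenvector
    have hpow : μ ^ n = 1 := by
      have h := hv.pow_apply n
      rw [hf, Module.End.one_apply] at h
      exact (smul_left_injective ℂ hv.2 (by simpa using h)).symm
    exact Complex.norm_eq_one_of_pow_eq_one hpow hn
  have hre : ∀ μ ∈ f.charpoly.roots, μ.re ≤ 1 := fun μ hμ ↦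
    (Complex.re_le_norm μ).trans_eq (hnorm μ hμ)
  have hsum : (f.charpoly.roots.map (fun μ ↦ 1 - μ.re)).sum = 0 := by
    rw [Module.End.trace_eq_sum_roots_charpoly_of_splits hsplits] at htr
    have h : (f.charpoly.roots.map Complex.re).sum = Module.finrank ℂ W := by
      simpa [map_multiset_sum] using congrArg Complex.reAddGroupHom htr
    rw [Multiset.sum_map_sub, h]
    simp [hcard]
  have hone : ∀ μ ∈ f.charpoly.roots, μ = 1 := by
    intro μ hμ
    have hmem : 1 - μ.re ∈ f.charpoly.roots.map (fun μ ↦ 1 - μ.re) :=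
      Multiset.mem_map_of_mem _ hμ
    have hle : 1 - μ.re ≤ 0 := hsum ▸ Multiset.single_le_sum (by
      intro x hx
      obtain ⟨ν, hν, rfl⟩ := Multiset.mem_map.1 hx
      linarith [hre ν hν]) _ hmem
    have h1 : μ.re = 1 := by linarith [hre μ hμ]
    have h2 := Complex.sq_norm_sub_sq_re μ
    rw [hnorm μ hμ, h1] at h2
    exact Complex.ext h1 (by simpa using h2.symm)
  have hchar : f.charpoly = (Polynomial.X - Polynomial.C 1) ^ Module.finrank ℂ W := by
    rw [hsplits.eq_prod_roots_of_monic f.charpoly_monic, ← hcard,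
      Multiset.eq_replicate_card.2 hone]
    simp
  have hnil : IsNilpotent (f - algebraMap ℂ _ 1) :=
    ⟨_, by simpa [hchar] using f.aeval_self_charpoly⟩
  have hss : f.IsSemisimple := by
    refine Module.End.isSemisimple_of_squarefree_aeval_eq_zero
      (p := Polynomial.X ^ n - Polynomial.C 1) ?_ (by simp [hf])
    exact (Polynomial.separable_X_pow_sub_C 1 (by exact_mod_cast hn) one_ne_zero).squarefree
  have := Module.End.eq_zero_of_isNilpotent_isSemisimple hnil
    (Module.End.isSemisimple_sub_algebraMap_iff.2 hss)
  simpa [sub_eq_zero] using this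

open scoped MonoidAlgebra in
theorem Representation.ofModule'_apply {k G S : Type*} [CommSemiring k] [Monoid G]
    [AddCommMonoid S] [Module k S] [Module k[G] S] [IsScalarTower k k[G] S] (g : G) (s : S) :
    Representation.ofModule' (k := k) (G := G) S g s = (MonoidAlgebra.single g 1 : k[G]) • s := by
  simp [Representation.ofModule']

open scoped MonoidAlgebra in
/-- The representation on a simple module over the group algebra is irreducible. -/
theorem Representation.isIrreducible_ofModule' {k G S : Type*} [Field k] [Monoid G]
    [AddCommGroup S] [Module k S] [Module k[G] S] [IsScalarTower k k[G] S] [IsSimpleModule k[G] S] :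
    (Representation.ofModule' (k := k) (G := G) S).IsIrreducible := by
  rw [Representation.irreducible_iff_isSimpleModule_asModule]
  let ρ := Representation.ofModule' (k := k) (G := G) S
  let e : ρ.asModule ≃ₗ[k[G]] S :=
    { ρ.asModuleEquiv.toAddEquiv with
      map_smul' r s := by
        change ρ.asModuleEquiv (r • s) = r • ρ.asModuleEquiv s
        have h : ρ.asAlgebraHom = Algebra.lsmul k k S :=
          (MonoidAlgebra.lift k (S →ₗ[k] S) G).apply_symm_apply _
        rw [Representation.asModuleEquiv_map_smul, h]
        rfl }
  exact .congr e

section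

variable {G : Type} [Group G]

/-- The kernel of a character of a finite group is the kernel of the representation. -/
theorem charKer_eq_ker [Finite G] (V : FDRep ℂ G) : charKer V = (V.ρ.ker : Set G) := by
  ext g
  simp only [charKer, Set.mem_ofPred_eq, SetLike.mem_coe, MonoidHom.mem_ker]
  refine ⟨fun h ↦ ?_, fun h ↦ by simp [FDRep.character, h]⟩
  rw [FDRep.char_one] at h
  exact Module.End.eq_one_of_pow_eq_one_of_trace_eq_finrank (orderOf_pos g).ne'
    (by rw [← map_pow, pow_orderOf_eq_one, map_one]) h

/-- For every proper normal subgroup `K` of a finite `p`-group there is a normal subgroup of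
order `p` times the order of `K`. -/
theorem IsPGroup.exists_normal_card_eq_mul [Finite G] {p : ℕ} [Fact p.Prime] (hG : IsPGroup p G)
    (K : Subgroup G) [K.Normal] (hK : K ≠ ⊤) :
    ∃ N : Subgroup G, N.Normal ∧ Nat.card N = Nat.card K * p := by
  have hQ : IsPGroup p (G ⧸ K) := hG.to_quotient K
  have : Nontrivial (G ⧸ K) := QuotientGroup.nontrivial_iff.2 hK
  have := hQ.center_nontrivial
  obtain ⟨n, hn, hcard⟩ := (hQ.to_subgroup (Subgroup.center (G ⧸ K))).nontrivial_iff_card.1 this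
  obtain ⟨z, hz⟩ := exists_prime_orderOf_dvd_card' p (hcard ▸ dvd_pow_self p hn.ne')
  have hle : Subgroup.zpowers (z : G ⧸ K) ≤ Subgroup.center (G ⧸ K) := by simp
  have : (Subgroup.zpowers (z : G ⧸ K)).Normal := by
    refine ⟨fun x hx g ↦ ?_⟩
    rwa [Subgroup.mem_center_iff.1 (hle hx) g, mul_inv_cancel_right]
  refine ⟨(Subgroup.zpowers (z : G ⧸ K)).comap (QuotientGroup.mk' K), inferInstance, ?_⟩
  refine (QuotientGroup.card_preimage_mk K (Subgroup.zpowers (z : G ⧸ K))).trans ?_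
  congr 1
  rw [← hz, ← Subgroup.orderOf_coe]
  exact Nat.card_zpowers _

/-- Endomorphisms of a vector space of dimension at most one commute. -/
theorem Module.End.commute_of_finrank_le_one {k W : Type*} [Field k] [AddCommGroup W]
    [Module k W] [FiniteDimensional k W] (h : Module.finrank k W ≤ 1) (f g : Module.End k W) :
    Commute f g := by
  obtain ⟨v, hv⟩ := finrank_le_one_iff.1 h
  obtain ⟨c, hc⟩ := hv (f v)
  obtain ⟨d, hd⟩ := hv (g v)
  ext w
  obtain ⟨e, rfl⟩ := hv w
  simp [← hc, ← hd, smul_comm c d]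

/-- An irreducible complex representation of a finite group is simple as an object of `FDRep`. -/
theorem FDRep.simple_of_isIrreducible [Finite G] {W : Type} [AddCommGroup W] [Module ℂ W]
    [FiniteDimensional ℂ W] (ρ : Representation ℂ G W) [ρ.IsIrreducible] :
    Simple (FDRep.of ρ) := by
  have := Fintype.ofFinite G
  have := invertibleOfNonzero (NeZero.ne (Nat.card G : ℂ))
  rw [FDRep.simple_iff_char_is_norm_one]
  have h := ρ.char_orthonormal ρ
  rw [if_pos ⟨.refl ρ⟩, inv_mul_eq_one₀ (NeZero.ne _)] at h
  exact h.symm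

/-- A nonzero element of a semisimple module is nonzero in some simple quotient. -/
theorem IsSemisimpleModule.exists_isSimpleModule_quotient_notMem {R M : Type*} [Ring R]
    [AddCommGroup M] [Module R M] [IsSemisimpleModule R M] {x : M} (hx : x ≠ 0) :
    ∃ m : Submodule R M, IsSimpleModule R (M ⧸ m) ∧ x ∉ m := by
  have h : x ∉ Module.jacobson R M := by rwa [IsSemisimpleModule.jacobson_eq_bot]
  simp only [Module.jacobson, Submodule.mem_sInf, not_forall] at h
  obtain ⟨m, hm, hxm⟩ := h
  exact ⟨m, isSimpleModule_iff_isCoatom.2 hm, hxm⟩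

open scoped MonoidAlgebra in
/-- Two elements of `G` which differ modulo a normal subgroup `N` act differently on some simple
module over the group algebra on which `N` acts trivially. -/
theorem exists_isSimpleModule_of_div_notMem [Finite G] (N : Subgroup G) [N.Normal]
    {a b : G} (hab : a / b ∉ N) :
    ∃ (S : Type) (_ : AddCommGroup S) (_ : Module ℂ[G] S), IsSimpleModule ℂ[G] S ∧
      (∀ n ∈ N, ∀ s : S, (MonoidAlgebra.single n 1 : ℂ[G]) • s = s) ∧
      ∃ s : S, (MonoidAlgebra.single a 1 : ℂ[G]) • s ≠ (MonoidAlgebra.single b 1 : ℂ[G]) • s := by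
  have := invertibleOfNonzero (NeZero.ne (Nat.card G : ℂ))
  let σ := Representation.ofMulAction ℂ G (G ⧸ N)
  have hσ (g : G) (v : σ.asModule) :
      (MonoidAlgebra.single g 1 : ℂ[G]) • v = σ.asModuleEquiv.symm (σ g (σ.asModuleEquiv v)) := by
    rw [Representation.single_smul, one_smul]
    rfl
  let δ : σ.asModule := σ.asModuleEquiv.symm (.single ((1 : G) : G ⧸ N) 1)
  have hδ (g : G) : (MonoidAlgebra.single g 1 : ℂ[G]) • δ =
      σ.asModuleEquiv.symm (.single (g : G ⧸ N) 1) := by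
    rw [hσ, LinearEquiv.apply_symm_apply, Representation.ofMulAction_single]
    change σ.asModuleEquiv.symm (.single ((g * 1 : G) : G ⧸ N) 1) = _
    rw [mul_one]
  have hne : (MonoidAlgebra.single a 1 : ℂ[G]) • δ - (MonoidAlgebra.single b 1 : ℂ[G]) • δ ≠ 0 := by
    rw [hδ, hδ, sub_ne_zero, σ.asModuleEquiv.symm.injective.ne_iff]
    intro h
    have h' := MonoidAlgebra.single_left_injective (one_ne_zero (α := ℂ)) h
    exact hab (by rwa [← QuotientGroup.eq_one_iff, QuotientGroup.mk_div, div_eq_one])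
  obtain ⟨m, hm, hmem⟩ := IsSemisimpleModule.exists_isSimpleModule_quotient_notMem (R := ℂ[G]) hne
  refine ⟨σ.asModule ⧸ m, inferInstance, inferInstance, hm, fun n hn s ↦ ?_, m.mkQ δ, fun h ↦ ?_⟩
  · obtain ⟨v, rfl⟩ := m.mkQ_surjective s
    have hn' : σ n = 1 := by
      refine MonoidAlgebra.lhom_ext' fun q ↦ LinearMap.ext_ring ?_
      obtain ⟨g, rfl⟩ := QuotientGroup.mk_surjective q
      have h : ((n * g : G) : G ⧸ N) = g := by
        rw [QuotientGroup.mk_mul, (QuotientGroup.eq_one_iff n).2 hn, one_mul]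
      simpa [σ] using congrArg (MonoidAlgebra.single · (1 : ℂ)) h
    rw [← map_smul, hσ, hn']
    simp
  · rw [← m.mkQ.map_smul, ← m.mkQ.map_smul, ← sub_eq_zero, ← map_sub] at h
    exact hmem (by simpa using h)

/-- Two elements which do not commute modulo a normal subgroup `N` are represented by
non-commuting operators in some irreducible representation that is trivial on `N`. -/
theorem exists_isIrreducible_of_commutator_notMem [Finite G] (N : Subgroup G) [N.Normal]
    {a b : G} (hab : a * b / (b * a) ∉ N) :
    ∃ (W : Type) (_ : AddCommGroup W) (_ : Module ℂ W) (_ : FiniteDimensional ℂ W)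
      (ρ : Representation ℂ G W), ρ.IsIrreducible ∧ N ≤ ρ.ker ∧ ¬ Commute (ρ a) (ρ b) := by
  obtain ⟨S, _, _, _, hN, s, hs⟩ := exists_isSimpleModule_of_div_notMem N hab
  let _ : Module ℂ S := Module.compHom S (algebraMap ℂ (MonoidAlgebra ℂ G))
  have : IsScalarTower ℂ (MonoidAlgebra ℂ G) S :=
    ⟨fun x y z ↦ by rw [Algebra.smul_def, mul_smul]; rfl⟩
  refine ⟨S, inferInstance, inferInstance, Module.Finite.trans (MonoidAlgebra ℂ G) S,
    Representation.ofModule' S, Representation.isIrreducible_ofModule', fun n hn ↦ ?_,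
    fun h ↦ hs ?_⟩
  · rw [MonoidHom.mem_ker]
    ext s
    rw [Representation.ofModule'_apply, hN n hn, Module.End.one_apply]
  · rw [← Representation.ofModule'_apply, ← Representation.ofModule'_apply, map_mul, map_mul, h.eq]

end

/-- If `m` is the largest non-negative integer such that some non-linear irreducible
complex character of the non-Abelian finite `p`-group `G` (`p` odd) has kernel of order
`p ^ m`, then either `G'` is the unique normal subgroup of `G` of order `p^{m+1}`, or
`|G'| ≤ p ^ m`. -/
theorem commutator_unique_or_small (p m : ℕ) (hp : p.Prime) (hodd : Odd p)
    (G : Type) [Group G] [Fintype G] (hpG : IsPGroup p G)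
    (hnab : ¬ ∀ a b : G, a * b = b * a)
    (hex : ∃ V : FDRep ℂ G, Simple V ∧ 1 < Module.finrank ℂ V ∧
      Nat.card (charKer V) = p ^ m)
    (hmax : ∀ k : ℕ, (∃ V : FDRep ℂ G, Simple V ∧ 1 < Module.finrank ℂ V ∧
      Nat.card (charKer V) = p ^ k) → k ≤ m) :
    (Nat.card (commutator G) = p ^ (m + 1) ∧
      ∀ N : Subgroup G, N.Normal → Nat.card N = p ^ (m + 1) → N = commutator G) ∨
    Nat.card (commutator G) ≤ p ^ m := by
  have := Fact.mk hp
  have hker (V : FDRep ℂ G) : Nat.card (charKer V) = Nat.card V.ρ.ker := by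
    rw [charKer_eq_ker]; rfl
  have hle (N : Subgroup G) (hN : N.Normal) (hcard : Nat.card N = p ^ (m + 1)) :
      commutator G ≤ N := by
    rw [commutator_def, Subgroup.commutator_le]
    by_contra! hcomm
    obtain ⟨a, -, b, -, hab⟩ := hcomm
    rw [commutatorElement_def, mul_assoc, ← mul_inv_rev, ← div_eq_mul_inv] at hab
    obtain ⟨W, _, _, _, ρ, _, hNρ, hnc⟩ := exists_isIrreducible_of_commutator_notMem N hab
    obtain ⟨k, hk⟩ := (hpG.to_subgroup ρ.ker).exists_card_eq
    have hkm : k ≤ m := hmax k ⟨FDRep.of ρ, FDRep.simple_of_isIrreducible ρ, by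
      by_contra! hW
      exact hnc (Module.End.commute_of_finrank_le_one hW _ _), (hker _).trans hk⟩
    have := Subgroup.card_le_of_le hNρ
    rw [hcard, hk] at this
    have := (Nat.pow_le_pow_iff_right hp.one_lt).1 this
    omega
  obtain ⟨V, -, -, hVm⟩ := hex
  by_cases htop : V.ρ.ker = ⊤
  · rw [hker, htop] at hVm
    exact .inr (hVm ▸ Subgroup.card_le_of_le le_top)
  obtain ⟨N, hN, hcard⟩ := hpG.exists_normal_card_eq_mul V.ρ.ker htop
  rw [← hker, hVm, ← pow_succ] at hcard
  obtain ⟨d, hd⟩ := (hpG.to_subgroup (commutator G)).exists_card_eq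
  have hdm := Subgroup.card_le_of_le (hle N hN hcard)
  rw [hd, hcard, Nat.pow_le_pow_iff_right hp.one_lt] at hdm
  obtain rfl | hlt := hdm.eq_or_lt
  · exact .inl ⟨hd, fun N hN hcard ↦
      (Subgroup.eq_of_le_of_card_ge (hle N hN hcard) (hcard.trans hd.symm).le).symm⟩
  · exact .inr (hd ▸ Nat.pow_le_pow_right hp.pos (Nat.lt_succ_iff.1 hlt))
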